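/- Let the q-cyclotomic classes modulo n have lengths ℓ_1, …, ℓ_r. Then the symbol-weight enumerator of F_n satisfies ∑_{f ∈ F_n} z^{wt_sym(f)} = ∏_{j=1}^r (1 + (q^{ℓ_j} − 1)·z^{ℓ_j}) as polynomials in ℤ[z], where wt_sym(f) = |{i : f_i ≠ 0}|. Equivalently, for each w the number of f ∈ F_n with exactly w nonzero coordinates equals the coefficient of z^w in the right-hand product. -/

import Mathlib

open scoped Classical

/-- The `q`-cyclotomic class of `s` modulo `n`, as a finset. -/
noncomputable def cycClass (q n : ℕ) [NeZero n] (s : ZMod n) : Finset (ZMod n) :=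
  Finset.univ.filter (fun x => ∃ t : ℕ, x = (q : ZMod n) ^ t * s)

/-- The set of all `q`-cyclotomic classes modulo `n`. -/
noncomputable def cycClasses (q n : ℕ) [NeZero n] : Finset (Finset (ZMod n)) :=
  Finset.univ.image (cycClass q n)

theorem cyc_self (q n : ℕ) [NeZero n] (s : ZMod n) : s ∈ cycClass q n s := by
  simp only [cycClass, Finset.mem_filter, Finset.mem_univ, true_and]
  exact ⟨0, by simp⟩

theorem cyc_eq (q m n : ℕ) (hm : 0 < m) [NeZero n] (h1 : (q : ZMod n) ^ m = 1) (s x : ZMod n) :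
    x ∈ cycClass q n s ↔ cycClass q n x = cycClass q n s := by
  constructor
  · intro h
    simp only [cycClass, Finset.mem_filter, Finset.mem_univ, true_and] at h
    obtain ⟨t, rfl⟩ := h
    ext y
    simp only [cycClass, Finset.mem_filter, Finset.mem_univ, true_and]
    constructor
    · rintro ⟨u, rfl⟩
      exact ⟨u + t, by ring⟩
    · rintro ⟨u, rfl⟩
      refine ⟨u + (m - 1) * t, ?_⟩
      have : (q : ZMod n) ^ ((m - 1) * t) * q ^ t = 1 := by
        rw [← pow_add, show (m - 1) * t + t = m * t by
          obtain ⟨k, rfl⟩ := Nat.exists_eq_succ_of_ne_zero hm.ne'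
          simp; ring, pow_mul, h1, one_pow]
      calc (q : ZMod n) ^ u * s = q ^ u * ((q : ZMod n) ^ ((m - 1) * t) * q ^ t) * s := by
            rw [this, mul_one]
        _ = _ := by ring
  · intro h
    rw [← h]
    exact cyc_self q n x

theorem iter_mul (q n : ℕ) (t : ℕ) (s : ZMod n) :
    (fun x : ZMod n => (q : ZMod n) * x)^[t] s = q ^ t * s := by
  rw [mul_left_iterate]

theorem iter_pow {L : Type*} [Field L] (q t : ℕ) (x : L) :
    (fun x : L => x ^ q)^[t] x = x ^ q ^ t := by
  rw [pow_iterate]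

theorem cyc_card (q m n : ℕ) (hm : 0 < m) [NeZero n] (h1 : (q : ZMod n) ^ m = 1) (s : ZMod n) :
    (cycClass q n s).card = Function.minimalPeriod (fun x : ZMod n => (q : ZMod n) * x) s := by
  have hp : Function.IsPeriodicPt (fun x : ZMod n => (q : ZMod n) * x) m s := by
    rw [Function.IsPeriodicPt, Function.IsFixedPt, iter_mul, h1, one_mul]
  have hpos := hp.minimalPeriod_pos hm
  have : cycClass q n s = (Finset.range (Function.minimalPeriod
      (fun x : ZMod n => (q : ZMod n) * x) s)).image
      (fun t => (fun x : ZMod n => (q : ZMod n) * x)^[t] s) := by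
    ext y
    simp only [cycClass, Finset.mem_filter, Finset.mem_univ, true_and, Finset.mem_image,
      Finset.mem_range]
    constructor
    · rintro ⟨t, rfl⟩
      refine ⟨t % _, Nat.mod_lt _ hpos, ?_⟩
      rw [Function.iterate_mod_minimalPeriod_eq, iter_mul]
    · rintro ⟨t, -, rfl⟩
      exact ⟨t, iter_mul q n t s⟩
  rw [this, Finset.card_image_of_injOn, Finset.card_range]
  intro a ha b hb hab
  simp only [Finset.coe_range, Set.mem_Iio] at ha hb
  exact (Function.iterate_eq_iterate_iff_of_lt_minimalPeriod ha hb).1 hab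

theorem per_wd {L : Type*} [Field L] (q m n : ℕ) (hm : 0 < m) [NeZero n]
    (h1 : (q : ZMod n) ^ m = 1) (s : ZMod n) (x : L)
    (hx : x ^ q ^ (cycClass q n s).card = x) (a b : ℕ)
    (hab : (q : ZMod n) ^ a * s = q ^ b * s) : x ^ q ^ a = x ^ q ^ b := by
  rw [cyc_card q m n hm h1] at hx
  have hp : Function.IsPeriodicPt (fun x : ZMod n => (q : ZMod n) * x) m s := by
    rw [Function.IsPeriodicPt, Function.IsFixedPt, iter_mul, h1, one_mul]
  have hpos := hp.minimalPeriod_pos hm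
  set l := Function.minimalPeriod (fun x : ZMod n => (q : ZMod n) * x) s with hl
  have hxp : Function.IsPeriodicPt (fun x : L => x ^ q) l x := by
    rw [Function.IsPeriodicPt, Function.IsFixedPt, iter_pow, hx]
  rw [← iter_mul, ← iter_mul, ← Function.iterate_mod_minimalPeriod_eq (n := a),
    ← Function.iterate_mod_minimalPeriod_eq (n := b)] at hab
  have := (Function.iterate_eq_iterate_iff_of_lt_minimalPeriod
    (Nat.mod_lt _ hpos) (Nat.mod_lt _ hpos)).1 hab
  rw [← iter_pow, ← iter_pow, ← hxp.iterate_mod_apply a, ← hxp.iterate_mod_apply b, this]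

theorem sum_T {L : Type*} [Field L] [Fintype L] (q m l : ℕ) (hq : 1 < q)
    (hL : Fintype.card L = q ^ m) (hl : 0 < l) (hlm : l ∣ m) :
    ∑ x : {x : L // x ^ q ^ l = x},
      (if x.1 ≠ 0 then (Polynomial.X : Polynomial ℤ) ^ l else 1) =
    1 + ((q ^ l - 1 : ℕ) : Polynomial ℤ) * Polynomial.X ^ l := by
  have hql : 1 < q ^ l := Nat.one_lt_pow hl.ne' hq
  have key : (Finset.univ.filter (fun x : L => x ^ q ^ l = x ∧ x ≠ 0)).card = q ^ l - 1 := by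
    have hd : q ^ l - 1 ∣ Nat.card Lˣ := by
      rw [Nat.card_eq_fintype_card, Fintype.card_units, hL]
      exact Nat.pow_sub_one_dvd_pow_sub_one q hlm
    rw [Nat.card_eq_fintype_card] at hd
    have h2 : (Finset.univ.filter (fun u : Lˣ => u ^ (q ^ l - 1) = 1)).card = q ^ l - 1 := by
      rw [← sum_card_orderOf_eq_card_pow_eq_one (by omega)]
      conv_rhs => rw [← Nat.sum_totient (q ^ l - 1)]
      apply Finset.sum_bij (fun a _ => a)
      · intro a ha
        simp only [Finset.mem_filter, Finset.mem_range, Nat.mem_divisors] at ha ⊢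
        exact ⟨by grind, by omega⟩
      · intro a _ b _ h
        exact h
      · intro a ha
        refine ⟨a, ?_, rfl⟩
        have := Nat.divisor_le ha
        simp only [Finset.mem_filter, Finset.mem_range, Nat.mem_divisors] at ha ⊢
        grind
      · intro a ha
        apply IsCyclic.card_orderOf_eq_totient
        refine dvd_trans ?_ hd
        grind
    rw [← h2]
    symm
    apply Finset.card_bij (fun (u : Lˣ) _ => (u : L))
    · intro u hu
      simp only [Finset.mem_filter, Finset.mem_univ, true_and] at hu ⊢
      refine ⟨?_, u.ne_zero⟩
      have : u ^ q ^ l = u := by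
        rw [show q ^ l = q ^ l - 1 + 1 by omega, pow_succ, hu, one_mul]
      exact_mod_cast congrArg Units.val this
    · intro a _ b _ h
      exact Units.ext h
    · intro x hx
      simp only [Finset.mem_filter, Finset.mem_univ, true_and] at hx
      refine ⟨Units.mk0 x hx.2, ?_, rfl⟩
      simp only [Finset.mem_filter, Finset.mem_univ, true_and]
      apply Units.ext
      have h3 := hx.1
      rw [show q ^ l = q ^ l - 1 + 1 by omega, pow_succ] at h3
      simpa using mul_right_cancel₀ hx.2 (h3.trans (one_mul x).symm)
  rw [← Finset.sum_subtype (Finset.univ.filter (fun x : L => x ^ q ^ l = x)) (by simp)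
    (fun x : L => if x ≠ 0 then (Polynomial.X : Polynomial ℤ) ^ l else 1)]
  rw [Finset.sum_ite, Finset.sum_const, Finset.sum_const, Finset.filter_filter,
    Finset.filter_filter, key]
  have : (Finset.univ.filter (fun x : L => x ^ q ^ l = x ∧ ¬ x ≠ 0)) = {0} := by
    ext x
    simp only [Finset.mem_filter, Finset.mem_univ, true_and, Finset.mem_singleton, not_not]
    constructor
    · exact fun h => h.2
    · rintro rfl
      exact ⟨zero_pow (by omega), rfl⟩
  rw [this]
  simp only [Finset.card_singleton, nsmul_eq_mul]
  push_cast
  ring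

/-- the symbol-weight enumerator of the Frobenius-consistent code `F_n`
is `∏_C (1 + (q^{|C|} - 1) z^{|C|})`, the product running over the `q`-cyclotomic
classes modulo `n`. -/
theorem stmt_10 (q m n : ℕ) (hq : IsPrimePow q) (hm : 0 < m)
    (L : Type*) [Field L] [Fintype L] (hL : Fintype.card L = q ^ m)
    [NeZero n] (hn : n ∣ q ^ m - 1) :
    ∑ f : {f : ZMod n → L // ∀ i, f ((q : ZMod n) * i) = f i ^ q},
        (Polynomial.X : Polynomial ℤ) ^
          (Finset.univ.filter (fun i : ZMod n => f.1 i ≠ 0)).card =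
      ∏ C ∈ cycClasses q n,
        (1 + ((q ^ C.card - 1 : ℕ) : Polynomial ℤ) * Polynomial.X ^ C.card) := by
  have hq1 : 1 < q := hq.one_lt
  have h1 : (q : ZMod n) ^ m = 1 := by
    have h := (ZMod.natCast_eq_zero_iff _ _).2 hn
    rw [Nat.cast_sub (Nat.one_le_pow _ _ (by omega))] at h
    push_cast at h
    exact sub_eq_zero.1 h
  have hex : ∀ C : {C // C ∈ cycClasses q n}, ∃ s, cycClass q n s = C.1 := by
    rintro ⟨C, hC⟩
    simpa [cycClasses] using hC
  choose rep hrep using hex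
  let cl : ZMod n → {C // C ∈ cycClasses q n} := fun i =>
    ⟨cycClass q n i, Finset.mem_image_of_mem _ (Finset.mem_univ i)⟩
  have hiter : ∀ f : {f : ZMod n → L // ∀ i, f ((q : ZMod n) * i) = f i ^ q},
      ∀ (t : ℕ) (i : ZMod n), f.1 ((q : ZMod n) ^ t * i) = f.1 i ^ q ^ t := by
    intro f t i
    induction t with
    | zero => simp
    | succ t ih => rw [pow_succ', mul_assoc, f.2, ih, ← pow_mul, pow_succ]
  have hclrep : ∀ i, ∃ t : ℕ, i = (q : ZMod n) ^ t * rep (cl i) := by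
    intro i
    have : i ∈ cycClass q n (rep (cl i)) := by
      rw [hrep]
      exact cyc_self q n i
    simpa [cycClass] using this
  have hlast : ∀ s, (q : ZMod n) ^ (cycClass q n s).card * s = s := by
    intro s
    rw [cyc_card q m n hm h1, ← iter_mul, Function.iterate_minimalPeriod]
  have hcard : ∀ s, (cycClass q n s).card ∣ m := by
    intro s
    rw [cyc_card q m n hm h1]
    apply Function.IsPeriodicPt.minimalPeriod_dvd
    rw [Function.IsPeriodicPt, Function.IsFixedPt, iter_mul, h1, one_mul]
  have hcl_mul : ∀ i, cl ((q : ZMod n) * i) = cl i := by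
    intro i
    apply Subtype.ext
    apply (cyc_eq q m n hm h1 _ _).1
    simp only [cycClass, Finset.mem_filter, Finset.mem_univ, true_and]
    exact ⟨1, by simp⟩
  have hcl_rep : ∀ C, cl (rep C) = C := fun C => Subtype.ext (hrep C)
  have hmain : ∑ f : {f : ZMod n → L // ∀ i, f ((q : ZMod n) * i) = f i ^ q},
        (Polynomial.X : Polynomial ℤ) ^
          (Finset.univ.filter (fun i : ZMod n => f.1 i ≠ 0)).card =
      ∑ g : (∀ C : {C // C ∈ cycClasses q n}, {x : L // x ^ q ^ C.1.card = x}),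
        ∏ C, (if (g C).1 ≠ 0 then (Polynomial.X : Polynomial ℤ) ^ C.1.card else 1) := by
    have hper : ∀ (f : {f : ZMod n → L // ∀ i, f ((q : ZMod n) * i) = f i ^ q})
        (C : {C // C ∈ cycClasses q n}), f.1 (rep C) ^ q ^ C.1.card = f.1 (rep C) := by
      intro f C
      rw [← hiter, ← hrep, hlast]
    refine Fintype.sum_bijective (fun f C => ⟨f.1 (rep C), hper f C⟩) ?_ _ _ ?_
    · constructor
      · intro f f' h
        apply Subtype.ext
        funext i
        obtain ⟨t, ht⟩ := hclrep i
        have h2 := congrArg Subtype.val (congrFun h (cl i))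
        simp only at h2
        rw [ht, hiter, hiter, h2]
      · intro g
        choose τ hτ using hclrep
        have hwd : ∀ (C) (a b : ℕ), (q : ZMod n) ^ a * rep C = q ^ b * rep C →
            (g C).1 ^ q ^ a = (g C).1 ^ q ^ b := by
          intro C a b hab
          refine per_wd q m n hm h1 (rep C) (g C).1 ?_ a b hab
          rw [hrep]
          exact (g C).2
        refine ⟨⟨fun i => (g (cl i)).1 ^ q ^ τ i, ?_⟩, ?_⟩
        · intro i
          have h3 := hτ (q * i)
          simp only
          rw [hcl_mul] at h3 ⊢
          rw [← pow_mul, ← pow_succ]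
          apply hwd
          rw [← h3, pow_succ', mul_assoc, ← hτ i]
        · funext C
          apply Subtype.ext
          simp only
          have h3 := hτ (rep C)
          rw [hcl_rep] at h3 ⊢
          rw [hwd C _ 0 (by rw [← h3]; simp)]
          simp
    · intro f
      simp only
      rw [← Finset.prod_const, Finset.prod_filter,
        ← Finset.prod_fiberwise (s := Finset.univ) (g := cl)]
      apply Finset.prod_congr rfl
      intro C _
      have hC : Finset.univ.filter (fun i => cl i = C) = C.1 := by
        ext i
        simp only [Finset.mem_filter, Finset.mem_univ, true_and]
        rw [← hrep C, cyc_eq q m n hm h1, hrep, Subtype.ext_iff]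
      rw [hC]
      have : ∀ i ∈ C.1, (if f.1 i ≠ 0 then (Polynomial.X : Polynomial ℤ) else 1) =
          if f.1 (rep C) ≠ 0 then Polynomial.X else 1 := by
        intro i hi
        rw [← hC] at hi
        simp only [Finset.mem_filter, Finset.mem_univ, true_and] at hi
        obtain ⟨t, ht⟩ := hclrep i
        rw [hi] at ht
        have hz : f.1 i ≠ 0 ↔ f.1 (rep C) ≠ 0 := by
          rw [ht, hiter, Ne, pow_eq_zero_iff (pow_pos (by omega) t).ne']
        simp only [hz]
      rw [Finset.prod_congr rfl this, Finset.prod_const]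
      split_ifs <;> simp
  rw [hmain, ← Fintype.prod_sum (fun (C : {C // C ∈ cycClasses q n})
    (x : {x : L // x ^ q ^ C.1.card = x}) =>
      if x.1 ≠ 0 then (Polynomial.X : Polynomial ℤ) ^ C.1.card else 1), ← Finset.prod_coe_sort (cycClasses q n)]
  apply Finset.prod_congr rfl
  intro C _
  have hd : C.1.card ∣ m := by
    rw [← hrep]
    exact hcard _
  exact sum_T q m C.1.card hq1 hL (Nat.pos_of_dvd_of_pos hd hm) hd
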